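/- Logarithmic Tauberian limit in the critical case α = d/2 (from the proof of Lemma 4.8): for each d ∈ {1,2,3}, lim_{N→+∞} (log N)^{−1} · ∫_0^{+∞} r · e^{−r/N} · p_r^{d,d/2}(0,0) dr = f_1^{d,d/2}(0), where the limit is taken as the real parameter N tends to +∞ over N > 1. -/

import Mathlib

open MeasureTheory Filter Real Topology

/-- Euclidean (l²) norm of a vector in `Fin d → ℝ`. -/
noncomputable def l2norm {d : ℕ} (u : Fin d → ℝ) : ℝ := Real.sqrt (∑ i, u i ^ 2)

/-- Euclidean norm of a lattice point. -/
noncomputable def zl2 {d : ℕ} (y : Fin d → ℤ) : ℝ := l2norm (fun i => (y i : ℝ))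

/-- The symbol `Σ_{y ≠ 0} (cos(θ·y) − 1)/‖y‖₂^{d+α}` of the long-range random walk. -/
noncomputable def latticeSymbol (d : ℕ) (α : ℝ) (θ : Fin d → ℝ) : ℝ :=
  ∑' y : {y : Fin d → ℤ // y ≠ 0},
    (Real.cos (∑ i, θ i * (y.1 i : ℝ)) - 1) / zl2 y.1 ^ ((d : ℝ) + α)

/-- Transition probability `p_t^{d,α}(0,x)` of the long-range random walk, defined through
the Fourier inversion formula. -/
noncomputable def pTrans (d : ℕ) (α : ℝ) (t : ℝ) (x : Fin d → ℤ) : ℝ :=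
  ((2 * Real.pi) ^ d)⁻¹ *
    ∫ θ in Set.univ.pi (fun _ : Fin d => Set.Icc (-Real.pi) Real.pi),
      Real.exp (t * latticeSymbol d α θ) * Real.cos (∑ i, (x i : ℝ) * θ i)

/-- The constant `G̃^{d,α} = ∫_{R^d} (1 − cos v₁)/‖v‖₂^{d+α} dv`. -/
noncomputable def Gtilde (d : ℕ) (α : ℝ) : ℝ :=
  ∫ v : Fin d → ℝ, (1 - Real.cos (if h : 0 < d then v ⟨0, h⟩ else 0)) / l2norm v ^ ((d : ℝ) + α)

/-- The density `f_t^{d,α}` of the limiting stable law (case `0 < α < 2`). -/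
noncomputable def fDensity (d : ℕ) (α : ℝ) (t : ℝ) (u : Fin d → ℝ) : ℝ :=
  ((2 * Real.pi) ^ d)⁻¹ *
    ∫ θ : Fin d → ℝ, Real.cos (∑ i, θ i * u i) * Real.exp (-(t * l2norm θ ^ α * Gtilde d α))

/-! ### Radial integrability -/

/-- The stretched exponential `exp (-c ‖x‖ ^ p)` is integrable for a Haar measure. -/
lemma integrable_exp_neg_mul_norm_rpow {E : Type*} [NormedAddCommGroup E] [NormedSpace ℝ E]
    [MeasurableSpace E] [BorelSpace E] [FiniteDimensional ℝ E] [Nontrivial E] (μ : Measure E)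
    [μ.IsAddHaarMeasure] {c p : ℝ} (hc : 0 < c) (hp : 0 < p) :
    Integrable (fun x : E => Real.exp (-c * ‖x‖ ^ p)) μ := by
  have h := integrable_fun_norm_addHaar μ (f := fun y : ℝ => Real.exp (-c * y ^ p))
  refine h.2 ?_
  have h2 := integrableOn_rpow_mul_exp_neg_mul_rpow
    (s := ((Module.finrank ℝ E - 1 : ℕ) : ℝ)) (p := p) (b := c)
    (lt_of_lt_of_le (by norm_num) (Nat.cast_nonneg _)) hp hc
  refine h2.congr_fun (fun y _ => ?_) measurableSet_Ioi
  simp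

/-- The radial profile `y ^ (δ - d)` for `y ≤ 1`, `y ^ (-d - α)` for `y > 1`. -/
noncomputable def radialProfile (d : ℕ) (α δ : ℝ) (y : ℝ) : ℝ :=
  if y ≤ 1 then y ^ (δ - d) else y ^ (-(d : ℝ) - α)

lemma integrable_radialProfile_norm {d : ℕ} (hd : 1 ≤ d) {α δ : ℝ} (hα : 0 < α) (hδ : 0 < δ) :
    Integrable (fun v : Fin d → ℝ => radialProfile d α δ ‖v‖) := by
  have : Nonempty (Fin d) := ⟨⟨0, hd⟩⟩
  refine (integrable_fun_norm_addHaar volume (f := radialProfile d α δ)).2 ?_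
  have hpow : ∀ y : ℝ, 0 < y → ∀ s : ℝ, y ^ (d - 1) * y ^ s = y ^ ((d : ℝ) - 1 + s) := by
    intro y hy s
    rw [← Real.rpow_natCast, ← Real.rpow_add hy, Nat.cast_sub hd, Nat.cast_one]
  rw [← Set.Ioc_union_Ioi_eq_Ioi (zero_le_one' ℝ)]
  refine IntegrableOn.union ?_ ?_
  · rw [integrableOn_Ioc_iff_integrableOn_Ioo]
    refine ((intervalIntegral.integrableOn_Ioo_rpow_iff (s := δ - 1) one_pos).2
      (by linarith)).congr_fun (fun y hy => ?_) measurableSet_Ioo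
    simp only [radialProfile, if_pos hy.2.le, Module.finrank_fin_fun, smul_eq_mul]
    rw [hpow y hy.1]
    ring_nf
  · refine (integrableOn_Ioi_rpow_of_lt (a := -1 - α) (by linarith) one_pos).congr_fun
      (fun y hy => ?_) measurableSet_Ioi
    have hy : (1 : ℝ) < y := hy
    simp only [radialProfile, if_neg (not_le.2 hy), Module.finrank_fin_fun, smul_eq_mul]
    rw [hpow y (by linarith)]
    ring_nf

/-! ### The Euclidean norm on `Fin d → ℝ` -/

lemma l2norm_eq_norm_toLp {d : ℕ} (v : Fin d → ℝ) : l2norm v = ‖WithLp.toLp 2 v‖ := by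
  simp [l2norm, EuclideanSpace.norm_eq]

lemma l2norm_nonneg {d : ℕ} (v : Fin d → ℝ) : 0 ≤ l2norm v := Real.sqrt_nonneg _

lemma l2norm_smul {d : ℕ} (c : ℝ) (v : Fin d → ℝ) : l2norm (c • v) = |c| * l2norm v := by
  rw [l2norm_eq_norm_toLp, l2norm_eq_norm_toLp, WithLp.toLp_smul, norm_smul, Real.norm_eq_abs]

lemma continuous_l2norm {d : ℕ} : Continuous (l2norm : (Fin d → ℝ) → ℝ) := by
  unfold l2norm
  fun_prop

lemma norm_le_l2norm {d : ℕ} (v : Fin d → ℝ) : ‖v‖ ≤ l2norm v := by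
  refine (pi_norm_le_iff_of_nonneg (l2norm_nonneg v)).2 fun i => ?_
  rw [Real.norm_eq_abs]
  refine Real.abs_le_sqrt ?_
  exact Finset.single_le_sum (f := fun i => v i ^ 2) (fun j _ => sq_nonneg _) (Finset.mem_univ i)

lemma l2norm_le_mul_norm {d : ℕ} (v : Fin d → ℝ) : l2norm v ≤ d * ‖v‖ := by
  refine Real.sqrt_le_iff.2 ⟨by positivity, ?_⟩
  have h : ∀ i ∈ Finset.univ, v i ^ 2 ≤ ‖v‖ ^ 2 := fun i _ => by
    rw [← sq_abs]
    exact pow_le_pow_left₀ (abs_nonneg _) (norm_le_pi_norm v i) 2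
  have h2 := Finset.sum_le_card_nsmul _ _ _ h
  simp only [Finset.card_univ, Fintype.card_fin, nsmul_eq_mul] at h2
  have h3 : (d : ℝ) ≤ (d : ℝ) ^ 2 := by
    exact_mod_cast Nat.le_self_pow two_ne_zero d
  nlinarith [sq_nonneg ‖v‖]

lemma l2norm_pos {d : ℕ} {v : Fin d → ℝ} (hv : v ≠ 0) : 0 < l2norm v :=
  (norm_pos_iff.2 hv).trans_le (norm_le_l2norm v)

lemma l2norm_zero {d : ℕ} : l2norm (0 : Fin d → ℝ) = 0 := by simp [l2norm]

/-! ### The kernel of the symbol -/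

/-- The kernel `(1 - cos (η · w)) / ‖w‖₂ ^ (d + α)`. -/
noncomputable def symbolKernel (d : ℕ) (α : ℝ) (η w : Fin d → ℝ) : ℝ :=
  (1 - Real.cos (∑ i, η i * w i)) / l2norm w ^ ((d : ℝ) + α)

lemma symbolKernel_nonneg {d : ℕ} {α : ℝ} (η w : Fin d → ℝ) : 0 ≤ symbolKernel d α η w :=
  div_nonneg (by linarith [Real.cos_le_one (∑ i, η i * w i)])
    (Real.rpow_nonneg (l2norm_nonneg w) _)

lemma symbolKernel_zero_right {d : ℕ} {α : ℝ} (η : Fin d → ℝ) : symbolKernel d α η 0 = 0 := by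
  simp [symbolKernel]

lemma symbolKernel_zero_left {d : ℕ} {α : ℝ} (w : Fin d → ℝ) : symbolKernel d α 0 w = 0 := by
  simp [symbolKernel]

lemma measurable_symbolKernel {d : ℕ} {α : ℝ} :
    Measurable (fun z : (Fin d → ℝ) × (Fin d → ℝ) => symbolKernel d α z.1 z.2) := by
  unfold symbolKernel
  have h : Measurable (l2norm : (Fin d → ℝ) → ℝ) := continuous_l2norm.measurable
  fun_prop

lemma continuousAt_symbolKernel {d : ℕ} {α : ℝ} (η : Fin d → ℝ) {v : Fin d → ℝ} (hv : v ≠ 0) :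
    ContinuousAt (symbolKernel d α η) v := by
  unfold symbolKernel
  refine ContinuousAt.div (Continuous.continuousAt (by fun_prop)) ?_
    (Real.rpow_pos_of_pos (l2norm_pos hv) _).ne'
  exact continuous_l2norm.continuousAt.rpow_const (Or.inl (l2norm_pos hv).ne')

lemma symbolKernel_smul_left {d : ℕ} {α : ℝ} {ε : ℝ} (hε : 0 < ε) (η w : Fin d → ℝ) :
    symbolKernel d α (ε • η) w = ε ^ ((d : ℝ) + α) * symbolKernel d α η (ε • w) := by
  have hs : ∑ i, (ε • η) i * w i = ∑ i, η i * (ε • w) i := by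
    refine Finset.sum_congr rfl fun i _ => ?_
    simp only [Pi.smul_apply, smul_eq_mul]
    ring
  have hp := (Real.rpow_pos_of_pos hε ((d : ℝ) + α)).ne'
  simp only [symbolKernel, hs, l2norm_smul, abs_of_pos hε,
    Real.mul_rpow hε.le (l2norm_nonneg w)]
  rw [mul_div_assoc', mul_div_mul_left _ _ hp]

lemma one_sub_cos_le_two_mul_abs_rpow {x β : ℝ} (h0 : 0 ≤ β) (h2 : β ≤ 2) :
    1 - Real.cos x ≤ 2 * |x| ^ β := by
  rcases le_total |x| 1 with h | h
  · have h1 : |x| ^ (2 : ℝ) ≤ |x| ^ β := by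
      rcases (abs_nonneg x).eq_or_lt with h' | h'
      · rw [← h', Real.zero_rpow two_ne_zero]
        exact Real.rpow_nonneg le_rfl _
      · exact Real.rpow_le_rpow_of_exponent_ge h' h h2
    have h3 : |x| ^ (2 : ℝ) = x ^ 2 := by
      rw [← sq_abs]
      exact_mod_cast Real.rpow_natCast |x| 2
    have := Real.one_sub_sq_div_two_le_cos (x := x)
    rw [h3] at h1
    linarith [sq_nonneg x]
  · have := Real.one_le_rpow h h0
    linarith [Real.neg_one_le_cos x]

lemma abs_sum_mul_le {d : ℕ} (η w : Fin d → ℝ) : |∑ i, η i * w i| ≤ d * ‖η‖ * ‖w‖ := by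
  calc |∑ i, η i * w i| ≤ ∑ i, |η i * w i| := Finset.abs_sum_le_sum_abs _ _
    _ ≤ ∑ _i : Fin d, ‖η‖ * ‖w‖ := by
      refine Finset.sum_le_sum fun i _ => ?_
      rw [abs_mul]
      exact mul_le_mul (norm_le_pi_norm η i) (norm_le_pi_norm w i) (abs_nonneg _) (norm_nonneg _)
    _ = d * ‖η‖ * ‖w‖ := by simp [mul_assoc]

/-- Domination of the kernel at `w` by an integrable radial function at any `v` with
`‖v‖ ≤ 2 ‖w‖`. -/
lemma symbolKernel_le {d : ℕ} (hd : 1 ≤ d) {α δ : ℝ} (hα : 0 < α) (hδ : 0 < δ) (hδ1 : δ ≤ 1)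
    (hδ2 : α + δ ≤ 2) (η : Fin d → ℝ) {v w : Fin d → ℝ} (hw : w ≠ 0) (hv : v ≠ 0)
    (hvw : ‖v‖ ≤ 2 * ‖w‖) :
    symbolKernel d α η w ≤
      (2 * (d * ‖η‖) ^ (α + δ) + 2) * 2 ^ ((d : ℝ) + α) * radialProfile d α δ ‖v‖ := by
  have hd' : (1 : ℝ) ≤ d := by exact_mod_cast hd
  have hw0 : 0 < ‖w‖ := norm_pos_iff.2 hw
  have hv0 : 0 < ‖v‖ := norm_pos_iff.2 hv
  have hhalf : ‖v‖ / 2 ≤ ‖w‖ := by linarith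
  have hM : 0 ≤ (d * ‖η‖) ^ (α + δ) := by positivity
  have hmono : ∀ s : ℝ, 0 ≤ s → s ≤ d + α → ‖w‖ ^ (-s) ≤ 2 ^ ((d : ℝ) + α) * ‖v‖ ^ (-s) := by
    intro s hs hs'
    calc ‖w‖ ^ (-s) ≤ (‖v‖ / 2) ^ (-s) :=
          Real.rpow_le_rpow_of_nonpos (by positivity) hhalf (by linarith)
      _ = 2 ^ s * ‖v‖ ^ (-s) := by
          rw [Real.div_rpow hv0.le zero_le_two, Real.rpow_neg zero_le_two, div_inv_eq_mul, mul_comm]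
      _ ≤ _ := by
          gcongr
          norm_num
  have hden : ‖w‖ ^ ((d : ℝ) + α) ≤ l2norm w ^ ((d : ℝ) + α) :=
    Real.rpow_le_rpow hw0.le (norm_le_l2norm w) (by linarith)
  have hcos : 0 ≤ 1 - Real.cos (∑ i, η i * w i) := by
    linarith [Real.cos_le_one (∑ i, η i * w i)]
  have hF : symbolKernel d α η w ≤
      (1 - Real.cos (∑ i, η i * w i)) * ‖w‖ ^ (-((d : ℝ) + α)) := by
    rw [Real.rpow_neg hw0.le, ← div_eq_mul_inv]
    exact div_le_div_of_nonneg_left hcos (by positivity) hden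
  refine hF.trans ?_
  unfold radialProfile
  split_ifs with h
  · calc (1 - Real.cos (∑ i, η i * w i)) * ‖w‖ ^ (-((d : ℝ) + α))
        ≤ (2 * (d * ‖η‖ * ‖w‖) ^ (α + δ)) * ‖w‖ ^ (-((d : ℝ) + α)) := by
          gcongr
          refine (one_sub_cos_le_two_mul_abs_rpow (by linarith) hδ2).trans ?_
          gcongr
          exact abs_sum_mul_le η w
      _ = 2 * (d * ‖η‖) ^ (α + δ) * ‖w‖ ^ (-((d : ℝ) - δ)) := by
          rw [Real.mul_rpow (by positivity) hw0.le, ← mul_assoc, mul_assoc (2 * _),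
            ← Real.rpow_add hw0]
          ring_nf
      _ ≤ 2 * (d * ‖η‖) ^ (α + δ) * (2 ^ ((d : ℝ) + α) * ‖v‖ ^ (-((d : ℝ) - δ))) := by
          gcongr
          exact hmono _ (by linarith) (by linarith)
      _ ≤ (2 * (d * ‖η‖) ^ (α + δ) + 2) * (2 ^ ((d : ℝ) + α) * ‖v‖ ^ (-((d : ℝ) - δ))) := by
          gcongr
          linarith
      _ = _ := by rw [neg_sub, mul_assoc]
  · calc (1 - Real.cos (∑ i, η i * w i)) * ‖w‖ ^ (-((d : ℝ) + α))
        ≤ 2 * ‖w‖ ^ (-((d : ℝ) + α)) := by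
          gcongr
          linarith [Real.neg_one_le_cos (∑ i, η i * w i)]
      _ ≤ 2 * (2 ^ ((d : ℝ) + α) * ‖v‖ ^ (-((d : ℝ) + α))) := by
          gcongr
          exact hmono _ (by linarith) le_rfl
      _ ≤ (2 * (d * ‖η‖) ^ (α + δ) + 2) * (2 ^ ((d : ℝ) + α) * ‖v‖ ^ (-((d : ℝ) + α))) := by
          gcongr
          linarith
      _ = _ := by rw [neg_add', mul_assoc]

/-! ### The symbol as an integral of a step function -/

/-- The lattice point below `v`, coordinatewise. -/
noncomputable def latticeFloor {d : ℕ} (v : Fin d → ℝ) : Fin d → ℤ := fun i => ⌊v i⌋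

/-- The rounding of `v` to the lattice `ε ℤ^d`. -/
noncomputable def roundTo {d : ℕ} (ε : ℝ) (v : Fin d → ℝ) : Fin d → ℝ :=
  fun i => ε * (⌊ε⁻¹ * v i⌋ : ℝ)

lemma measurable_latticeFloor {d : ℕ} : Measurable (latticeFloor : (Fin d → ℝ) → (Fin d → ℤ)) := by
  unfold latticeFloor
  fun_prop

lemma measurable_roundTo {d : ℕ} (ε : ℝ) : Measurable (roundTo ε : (Fin d → ℝ) → (Fin d → ℝ)) := by
  unfold roundTo
  refine measurable_pi_lambda _ fun i => ?_
  have h : Measurable (fun x : ℝ => (⌊x⌋ : ℝ)) := measurable_from_top.comp Int.measurable_floor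
  exact (h.comp (by fun_prop : Measurable fun v : Fin d → ℝ => ε⁻¹ * v i)).const_mul ε

lemma map_latticeFloor_volume {d : ℕ} :
    (volume : Measure (Fin d → ℝ)).map latticeFloor = Measure.count := by
  refine Measure.ext_iff_singleton.2 fun y => ?_
  rw [Measure.map_apply measurable_latticeFloor (measurableSet_singleton y),
    Measure.count_singleton]
  have h : (latticeFloor : (Fin d → ℝ) → (Fin d → ℤ)) ⁻¹' {y} =
      Set.univ.pi fun i => Set.Ico (y i : ℝ) (y i + 1) := by
    ext v
    simp [latticeFloor, funext_iff, Int.floor_eq_iff]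
  rw [h, Real.volume_pi_Ico]
  simp

lemma norm_roundTo_sub_le {d : ℕ} {ε : ℝ} (hε : 0 < ε) (v : Fin d → ℝ) :
    ‖roundTo ε v - v‖ ≤ ε := by
  refine (pi_norm_le_iff_of_nonneg hε.le).2 fun i => ?_
  simp only [Pi.sub_apply, roundTo, Real.norm_eq_abs]
  have h1 := Int.floor_le (ε⁻¹ * v i)
  have h2 := Int.lt_floor_add_one (ε⁻¹ * v i)
  have h3 : ε * (ε⁻¹ * v i) = v i := by field_simp
  have h4 := mul_le_mul_of_nonneg_left h1 hε.le
  have h5 := mul_le_mul_of_nonneg_left h2.le hε.le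
  rw [abs_le]
  constructor <;> nlinarith

lemma roundTo_zero {d : ℕ} (ε : ℝ) : roundTo ε (0 : Fin d → ℝ) = 0 := by
  ext i
  simp [roundTo]

lemma le_norm_roundTo {d : ℕ} {ε : ℝ} (hε : 0 < ε) {v : Fin d → ℝ} (hv : roundTo ε v ≠ 0) :
    ε ≤ ‖roundTo ε v‖ := by
  obtain ⟨i, hi⟩ := Function.ne_iff.1 hv
  have hi' : ⌊ε⁻¹ * v i⌋ ≠ 0 := fun h => hi (by simp [roundTo, h])
  refine le_trans ?_ (norm_le_pi_norm _ i)
  have h1 : (1 : ℝ) ≤ |(⌊ε⁻¹ * v i⌋ : ℝ)| := by exact_mod_cast Int.one_le_abs hi'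
  simp only [roundTo, Real.norm_eq_abs, abs_mul, abs_of_pos hε]
  nlinarith

lemma symbolKernel_roundTo_le {d : ℕ} (hd : 1 ≤ d) {α δ : ℝ} (hα : 0 < α) (hδ : 0 < δ)
    (hδ1 : δ ≤ 1) (hδ2 : α + δ ≤ 2) (η : Fin d → ℝ) {ε : ℝ} (hε : 0 < ε) (v : Fin d → ℝ) :
    ‖symbolKernel d α η (roundTo ε v)‖ ≤
      (2 * (d * ‖η‖) ^ (α + δ) + 2) * 2 ^ ((d : ℝ) + α) * radialProfile d α δ ‖v‖ := by
  rw [Real.norm_of_nonneg (symbolKernel_nonneg _ _)]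
  by_cases hw : roundTo ε v = 0
  · rw [hw, symbolKernel_zero_right]
    have : 0 ≤ radialProfile d α δ ‖v‖ := by
      unfold radialProfile
      split_ifs <;> positivity
    positivity
  · have hv : v ≠ 0 := by
      rintro rfl
      exact hw (roundTo_zero ε)
    refine symbolKernel_le hd hα hδ hδ1 hδ2 η hw hv ?_
    have h1 := norm_roundTo_sub_le hε v
    have h2 := le_norm_roundTo hε hw
    have h3 := norm_sub_norm_le v (roundTo ε v)
    rw [norm_sub_rev] at h3
    linarith

lemma exists_pos_le_one_add_le_two {α : ℝ} (hα : α < 2) : ∃ δ : ℝ, 0 < δ ∧ δ ≤ 1 ∧ α + δ ≤ 2 :=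
  ⟨min 1 (2 - α), lt_min one_pos (by linarith), min_le_left _ _, by
    linarith [min_le_right 1 (2 - α)]⟩

lemma integrable_symbolKernel_roundTo {d : ℕ} (hd : 1 ≤ d) {α : ℝ} (hα : 0 < α) (hα2 : α < 2)
    (η : Fin d → ℝ) {ε : ℝ} (hε : 0 < ε) :
    Integrable (fun v => symbolKernel d α η (roundTo ε v)) := by
  obtain ⟨δ, hδ, hδ1, hδ2⟩ := exists_pos_le_one_add_le_two hα2
  refine Integrable.mono' ((integrable_radialProfile_norm hd hα hδ).const_mul _) ?_
    (Eventually.of_forall fun v => symbolKernel_roundTo_le hd hα hδ hδ1 hδ2 η hε v)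
  exact (measurable_symbolKernel.comp
    (measurable_const.prodMk (measurable_roundTo ε))).aestronglyMeasurable

lemma symbolKernel_roundTo_one {d : ℕ} {α : ℝ} (η v : Fin d → ℝ) :
    symbolKernel d α η (roundTo 1 v) =
      symbolKernel d α η (fun i => (latticeFloor v i : ℝ)) := by
  congr 1
  ext i
  simp [roundTo, latticeFloor]

lemma summable_symbolKernel {d : ℕ} (hd : 1 ≤ d) {α : ℝ} (hα : 0 < α) (hα2 : α < 2)
    (η : Fin d → ℝ) :
    Summable (fun y : Fin d → ℤ => symbolKernel d α η (fun i => (y i : ℝ))) := by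
  have h := integrable_symbolKernel_roundTo hd hα hα2 η one_pos
  simp only [symbolKernel_roundTo_one] at h
  have h2 := (integrable_map_measure
    (f := latticeFloor) (μ := (volume : Measure (Fin d → ℝ)))
    (g := fun y : Fin d → ℤ => symbolKernel d α η (fun i => (y i : ℝ)))
    (measurable_of_countable _).aestronglyMeasurable
    measurable_latticeFloor.aemeasurable).2 h
  rw [map_latticeFloor_volume, integrable_count_iff] at h2
  exact h2.of_norm

lemma latticeSymbol_eq_neg_tsum {d : ℕ} (α : ℝ) (θ : Fin d → ℝ) :
    latticeSymbol d α θ = -∑' y : Fin d → ℤ, symbolKernel d α θ (fun i => (y i : ℝ)) := by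
  unfold latticeSymbol
  have h : ∀ y : {y : Fin d → ℤ // y ≠ 0},
      (Real.cos (∑ i, θ i * (y.1 i : ℝ)) - 1) / zl2 y.1 ^ ((d : ℝ) + α) =
        -symbolKernel d α θ (fun i => (y.1 i : ℝ)) := by
    intro y
    rw [symbolKernel, zl2, ← neg_div, neg_sub]
  simp only [h]
  rw [tsum_neg]
  congr 1
  refine tsum_subtype_eq_of_support_subset
    (f := fun y : Fin d → ℤ => symbolKernel d α θ (fun i => (y i : ℝ)))
    (s := {y | y ≠ 0}) fun y hy => ?_
  rintro rfl
  refine hy ?_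
  have : (fun i : Fin d => (((0 : Fin d → ℤ) i : ℤ) : ℝ)) = 0 := by
    ext i
    simp
  simp only [this, symbolKernel_zero_right]

lemma latticeSymbol_eq_neg_integral {d : ℕ} (hd : 1 ≤ d) {α : ℝ} (hα : 0 < α) (hα2 : α < 2)
    (θ : Fin d → ℝ) :
    latticeSymbol d α θ = -∫ v, symbolKernel d α θ (roundTo 1 v) := by
  have hs := summable_symbolKernel hd hα hα2 θ
  have hi : Integrable (fun y : Fin d → ℤ => symbolKernel d α θ (fun i => (y i : ℝ)))
      Measure.count := integrable_count_iff.2 hs.norm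
  rw [latticeSymbol_eq_neg_tsum]
  simp only [symbolKernel_roundTo_one]
  rw [← integral_map (μ := (volume : Measure (Fin d → ℝ)))
    (f := fun y : Fin d → ℤ => symbolKernel d α θ (fun i => (y i : ℝ)))
    measurable_latticeFloor.aemeasurable (measurable_of_countable _).aestronglyMeasurable,
    map_latticeFloor_volume, integral_countable hi]
  simp [Measure.real]

lemma latticeSymbol_nonpos {d : ℕ} (α : ℝ) (θ : Fin d → ℝ) : latticeSymbol d α θ ≤ 0 := by
  rw [latticeSymbol_eq_neg_tsum, neg_nonpos]
  exact tsum_nonneg fun y => symbolKernel_nonneg _ _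

lemma measurable_latticeSymbol {d : ℕ} (hd : 1 ≤ d) {α : ℝ} (hα : 0 < α) (hα2 : α < 2) :
    Measurable (latticeSymbol d α) := by
  have h : latticeSymbol d α = fun θ => -∫ v, symbolKernel d α θ (roundTo 1 v) :=
    funext (latticeSymbol_eq_neg_integral hd hα hα2)
  rw [h]
  refine Measurable.neg (StronglyMeasurable.integral_prod_right ?_).measurable
  exact (measurable_symbolKernel.comp (measurable_fst.prodMk
    ((measurable_roundTo 1).comp measurable_snd))).stronglyMeasurable

/-! ### Asymptotics of the symbol at the origin -/

lemma latticeSymbol_smul {d : ℕ} (hd : 1 ≤ d) {α : ℝ} (hα : 0 < α) (hα2 : α < 2)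
    {ε : ℝ} (hε : 0 < ε) (η : Fin d → ℝ) :
    latticeSymbol d α (ε • η) = -(ε ^ α * ∫ v, symbolKernel d α η (roundTo ε v)) := by
  rw [latticeSymbol_eq_neg_integral hd hα hα2]
  simp only [symbolKernel_smul_left hε]
  rw [integral_const_mul]
  have h1 : ∀ v : Fin d → ℝ, ε • roundTo 1 v = roundTo ε (ε • v) := by
    intro v
    ext i
    simp [roundTo, hε.ne']
  simp only [h1]
  rw [Measure.integral_comp_smul volume (fun v => symbolKernel d α η (roundTo ε v)) ε,
    Module.finrank_fin_fun, abs_of_pos (by positivity), smul_eq_mul, Real.rpow_add hε,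
    Real.rpow_natCast]
  have : ε ^ d ≠ 0 := (pow_pos hε d).ne'
  field_simp

lemma tendsto_roundTo {d : ℕ} (v : Fin d → ℝ) :
    Tendsto (fun ε : ℝ => roundTo ε v) (𝓝[>] 0) (𝓝 v) := by
  rw [tendsto_iff_norm_sub_tendsto_zero]
  refine squeeze_zero' (Eventually.of_forall fun _ => norm_nonneg _) ?_
    (tendsto_nhdsWithin_of_tendsto_nhds tendsto_id)
  filter_upwards [self_mem_nhdsWithin] with ε hε
  exact norm_roundTo_sub_le hε v

lemma tendsto_integral_symbolKernel_roundTo {d : ℕ} (hd : 1 ≤ d) {α : ℝ} (hα : 0 < α)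
    (hα2 : α < 2) (η : Fin d → ℝ) :
    Tendsto (fun ε : ℝ => ∫ v, symbolKernel d α η (roundTo ε v)) (𝓝[>] 0)
      (𝓝 (∫ v, symbolKernel d α η v)) := by
  obtain ⟨δ, hδ, hδ1, hδ2⟩ := exists_pos_le_one_add_le_two hα2
  refine tendsto_integral_filter_of_dominated_convergence _ ?_ ?_
    ((integrable_radialProfile_norm hd hα hδ).const_mul
      ((2 * (d * ‖η‖) ^ (α + δ) + 2) * 2 ^ ((d : ℝ) + α))) ?_
  · filter_upwards [self_mem_nhdsWithin] with ε hε
    exact (integrable_symbolKernel_roundTo hd hα hα2 η hε).aestronglyMeasurable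
  · filter_upwards [self_mem_nhdsWithin] with ε hε
    exact Eventually.of_forall fun v => symbolKernel_roundTo_le hd hα hδ hδ1 hδ2 η hε v
  · refine Eventually.of_forall fun v => ?_
    by_cases hv : v = 0
    · subst hv
      simp only [roundTo_zero]
      exact tendsto_const_nhds
    · exact (continuousAt_symbolKernel η hv).tendsto.comp (tendsto_roundTo v)

lemma integral_symbolKernel_eq_of_l2norm_eq {d : ℕ} {α : ℝ} {u u' : Fin d → ℝ}
    (h : l2norm u = l2norm u') :
    ∫ v, symbolKernel d α u v = ∫ v, symbolKernel d α u' v := by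
  have key : ∀ u : Fin d → ℝ, ∫ v, symbolKernel d α u v =
      ∫ v : EuclideanSpace ℝ (Fin d),
        (1 - Real.cos (inner ℝ v (WithLp.toLp 2 u))) / ‖v‖ ^ ((d : ℝ) + α) := by
    intro u
    rw [← (PiLp.volume_preserving_toLp (Fin d)).integral_comp
      (MeasurableEquiv.toLp 2 (Fin d → ℝ)).measurableEmbedding]
    refine integral_congr_ae (Eventually.of_forall fun v => ?_)
    simp [symbolKernel, l2norm_eq_norm_toLp, PiLp.inner_apply]
  rw [l2norm_eq_norm_toLp, l2norm_eq_norm_toLp] at h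
  rw [key, key]
  set R := (Submodule.span ℝ {WithLp.toLp 2 u - WithLp.toLp 2 u'})ᗮ.reflection with hR
  have hRu : R (WithLp.toLp 2 u) = WithLp.toLp 2 u' := Submodule.reflection_sub h
  rw [← R.measurePreserving.integral_comp R.toHomeomorph.measurableEmbedding
    (fun v => (1 - Real.cos (inner ℝ v (WithLp.toLp 2 u'))) / ‖v‖ ^ ((d : ℝ) + α))]
  simp only [← hRu, LinearIsometryEquiv.inner_map_map, LinearIsometryEquiv.norm_map]

lemma Gtilde_eq_integral_symbolKernel {d : ℕ} (hd : 1 ≤ d) (α : ℝ) :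
    Gtilde d α = ∫ v, symbolKernel d α (Pi.single ⟨0, hd⟩ 1) v := by
  simp [Gtilde, symbolKernel, Pi.single_apply, Nat.lt_of_lt_of_le Nat.zero_lt_one hd]

lemma integral_symbolKernel {d : ℕ} (hd : 1 ≤ d) {α : ℝ} (hα : 0 < α) (η : Fin d → ℝ) :
    ∫ v, symbolKernel d α η v = l2norm η ^ α * Gtilde d α := by
  by_cases hη : η = 0
  · simp [hη, symbolKernel_zero_left, l2norm_zero, Real.zero_rpow hα.ne']
  have hρ := l2norm_pos hη
  set ρ := l2norm η with hρ_def
  have he : l2norm (Pi.single ⟨0, hd⟩ 1 : Fin d → ℝ) = 1 := by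
    simp [l2norm, Pi.single_apply, ite_pow]
  have h1 : l2norm η = l2norm (ρ • (Pi.single ⟨0, hd⟩ 1 : Fin d → ℝ)) := by
    rw [l2norm_smul, he, abs_of_pos hρ, mul_one]
  rw [integral_symbolKernel_eq_of_l2norm_eq h1]
  simp only [symbolKernel_smul_left hρ]
  rw [integral_const_mul, Measure.integral_comp_smul volume
    (fun v => symbolKernel d α (Pi.single ⟨0, hd⟩ 1) v) ρ,
    Gtilde_eq_integral_symbolKernel hd,
    Module.finrank_fin_fun, abs_of_pos (by positivity), smul_eq_mul, Real.rpow_add hρ,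
    Real.rpow_natCast]
  have : ρ ^ d ≠ 0 := (pow_pos hρ d).ne'
  field_simp

/-- The rescaled symbol converges to the stable exponent. -/
lemma tendsto_rpow_neg_mul_latticeSymbol {d : ℕ} (hd : 1 ≤ d) {α : ℝ} (hα : 0 < α)
    (hα2 : α < 2) (η : Fin d → ℝ) :
    Tendsto (fun ε : ℝ => ε ^ (-α) * latticeSymbol d α (ε • η)) (𝓝[>] 0)
      (𝓝 (-(l2norm η ^ α * Gtilde d α))) := by
  rw [← integral_symbolKernel hd hα]
  refine (tendsto_integral_symbolKernel_roundTo hd hα hα2 η).neg.congr' ?_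
  filter_upwards [self_mem_nhdsWithin] with ε hε
  have hε : 0 < ε := hε
  rw [latticeSymbol_smul hd hα hα2 hε, Real.rpow_neg hε.le]
  have := (Real.rpow_pos_of_pos hε α).ne'
  field_simp

/-! ### A lower bound for the symbol -/

lemma half_le_one_sub_cos_add_one_sub_cos {a b : ℝ} (h : Real.cos (b - a) ≤ 0) :
    1 / 2 ≤ (1 - Real.cos a) + (1 - Real.cos b) := by
  rw [Real.cos_sub] at h
  have h1 := Real.sin_sq_add_cos_sq a
  have h2 := Real.sin_sq_add_cos_sq b
  have h3 : (Real.cos a + Real.cos b) ^ 2 ≤ (3 / 2) ^ 2 := by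
    nlinarith [sq_nonneg (Real.sin a + Real.sin b)]
  have h4 := abs_le_of_sq_le_sq' h3 (by norm_num)
  linarith [h4.2]

lemma exists_nat_mul_mem_Icc_pi {t : ℝ} (ht : 0 < t) (htπ : t ≤ Real.pi) :
    ∃ k : ℕ, 1 ≤ k ∧ k * t ≤ Real.pi ∧ Real.pi / 2 ≤ k * t := by
  have hq : 1 ≤ Real.pi / t := (one_le_div ht).2 htπ
  have hk : 1 ≤ ⌊Real.pi / t⌋₊ := (Nat.one_le_floor_iff _).2 hq
  have hk' : (1 : ℝ) ≤ (⌊Real.pi / t⌋₊ : ℝ) := by exact_mod_cast hk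
  refine ⟨⌊Real.pi / t⌋₊, hk, ?_, ?_⟩
  · exact (le_div_iff₀ ht).1 (Nat.floor_le (by linarith))
  · have h := (div_lt_iff₀ ht).1 (Nat.lt_floor_add_one (Real.pi / t))
    nlinarith

lemma one_sub_cos_div_le_symbolKernel {d : ℕ} {α : ℝ} (hα : 0 < α) (θ : Fin d → ℝ) {w : Fin d → ℝ}
    (hw : w ≠ 0) {R : ℝ} (hR : ‖w‖ ≤ R) :
    (1 - Real.cos (∑ i, θ i * w i)) / (d * R) ^ ((d : ℝ) + α) ≤ symbolKernel d α θ w := by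
  refine div_le_div_of_nonneg_left (by linarith [Real.cos_le_one (∑ i, θ i * w i)])
    (Real.rpow_pos_of_pos (l2norm_pos hw) _)
    (Real.rpow_le_rpow (l2norm_nonneg w) ?_ (by positivity))
  exact (l2norm_le_mul_norm w).trans (by gcongr)

/-- The symbol is bounded below by a multiple of `‖θ‖ ^ α` on the Brillouin zone. Lattice points
are paired along the dominant coordinate of `θ`. -/
lemma exists_mul_rpow_le_neg_latticeSymbol {d : ℕ} (hd : 1 ≤ d) {α : ℝ} (hα : 0 < α)
    (hα2 : α < 2) :
    ∃ c : ℝ, 0 < c ∧ ∀ θ : Fin d → ℝ, ‖θ‖ ≤ Real.pi →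
      c * ‖θ‖ ^ α ≤ -latticeSymbol d α θ := by
  have : Nonempty (Fin d) := ⟨⟨0, hd⟩⟩
  have hd0 : (0 : ℝ) < d := by exact_mod_cast hd
  refine ⟨((d * 2 : ℝ) ^ ((d : ℝ) + α))⁻¹ * (1 / 4) * (Real.pi ^ α)⁻¹, by positivity,
    fun θ hθ => ?_⟩
  by_cases hθ0 : θ = 0
  · subst hθ0
    rw [norm_zero, Real.zero_rpow hα.ne', mul_zero]
    exact neg_nonneg.2 (latticeSymbol_nonpos α _)
  have ht : 0 < ‖θ‖ := norm_pos_iff.2 hθ0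
  obtain ⟨i, hi⟩ := Finite.exists_max (fun i => |θ i|)
  have hi' : |θ i| = ‖θ‖ := le_antisymm (norm_le_pi_norm θ i)
    ((pi_norm_le_iff_of_nonneg (abs_nonneg _)).2 hi)
  obtain ⟨k, hk1, hkπ, hπk⟩ := exists_nat_mul_mem_Icc_pi ht hθ
  have hk0 : (0 : ℝ) < k := by exact_mod_cast hk1
  set f : (Fin d → ℤ) → ℝ := fun y => symbolKernel d α θ (fun i => (y i : ℝ)) with hf
  have hsum : Summable f := summable_symbolKernel hd hα hα2 θ
  have hf0 : ∀ y, 0 ≤ f y := fun y => symbolKernel_nonneg _ _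
  set S : Finset (Fin d → ℤ) := Fintype.piFinset fun _ => Finset.Icc (1 : ℤ) k with hS
  have hcard : (S.card : ℝ) = (k : ℝ) ^ d := by simp [hS]
  set sh : (Fin d → ℤ) ↪ (Fin d → ℤ) := addRightEmbedding (Pi.single i (k : ℤ)) with hsh
  have h1 : ∑ y ∈ S, f y ≤ ∑' y, f y := hsum.sum_le_tsum S fun y _ => hf0 y
  have h2 : ∑ y ∈ S, f (sh y) ≤ ∑' y, f y := by
    rw [← Finset.sum_map S sh f]
    exact hsum.sum_le_tsum _ fun y _ => hf0 y
  have hpair : ∀ y ∈ S, 1 / 2 / (d * (2 * k) : ℝ) ^ ((d : ℝ) + α) ≤ f y + f (sh y) := by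
    intro y hy
    have hy' : ∀ j, 1 ≤ y j ∧ y j ≤ k := by
      intro j
      simpa using (Fintype.mem_piFinset.1 hy) j
    have hshj : ∀ j, 1 ≤ sh y j ∧ sh y j ≤ 2 * k := by
      intro j
      have := hy' j
      simp only [hsh, addRightEmbedding_apply, Pi.add_apply, Pi.single_apply]
      split_ifs <;> omega
    have hnorm : ∀ z : Fin d → ℤ, (∀ j, 1 ≤ z j ∧ z j ≤ 2 * k) →
        ‖(fun j => (z j : ℝ))‖ ≤ 2 * k ∧ (fun j => (z j : ℝ)) ≠ 0 := by
      intro z hz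
      refine ⟨(pi_norm_le_iff_of_nonneg (by positivity)).2 fun j => ?_, fun h => ?_⟩
      · have h1 : (1 : ℝ) ≤ z j := by exact_mod_cast (hz j).1
        have h2 : (z j : ℝ) ≤ 2 * k := by exact_mod_cast (hz j).2
        rw [Real.norm_of_nonneg (by linarith)]
        exact h2
      · have h1 := congrFun h i
        have h2 := (hz i).1
        simp only [Pi.zero_apply, Int.cast_eq_zero] at h1
        omega
    obtain ⟨ha, ha0⟩ := hnorm y fun j => ⟨(hy' j).1, by have := (hy' j).2; omega⟩
    obtain ⟨hb, hb0⟩ := hnorm (sh y) hshj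
    refine le_trans ?_ (add_le_add (one_sub_cos_div_le_symbolKernel hα θ ha0 ha)
      (one_sub_cos_div_le_symbolKernel hα θ hb0 hb))
    rw [← add_div]
    refine div_le_div_of_nonneg_right (half_le_one_sub_cos_add_one_sub_cos ?_) (by positivity)
    have hdiff : ∑ j, θ j * (sh y j : ℝ) - ∑ j, θ j * (y j : ℝ) = θ i * k := by
      rw [← Finset.sum_sub_distrib]
      simp [hsh, ← mul_sub, Pi.single_apply]
    rw [hdiff, ← Real.cos_abs, abs_mul, hi', Nat.abs_cast]
    exact Real.cos_nonpos_of_pi_div_two_le_of_le (by linarith) (by linarith [Real.pi_pos])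
  have h3 := Finset.card_nsmul_le_sum S _ _ hpair
  rw [nsmul_eq_mul, hcard, Finset.sum_add_distrib] at h3
  have h4 : (k : ℝ) ^ d * (1 / 2 / (d * (2 * k) : ℝ) ^ ((d : ℝ) + α)) =
      2 * (((d * 2 : ℝ) ^ ((d : ℝ) + α))⁻¹ * (1 / 4) * ((k : ℝ) ^ α)⁻¹) := by
    have hA := (Real.rpow_pos_of_pos (by positivity : (0 : ℝ) < d * 2) ((d : ℝ) + α)).ne'
    have hB := (Real.rpow_pos_of_pos hk0 α).ne'
    rw [← mul_assoc, Real.mul_rpow (by positivity) hk0.le, Real.rpow_add hk0, Real.rpow_natCast]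
    field_simp
    norm_num
  have h5 : (Real.pi ^ α)⁻¹ * ‖θ‖ ^ α ≤ ((k : ℝ) ^ α)⁻¹ := by
    have hle : (k : ℝ) ^ α * ‖θ‖ ^ α ≤ Real.pi ^ α := by
      rw [← Real.mul_rpow hk0.le ht.le]
      exact Real.rpow_le_rpow (by positivity) hkπ hα.le
    have hB := Real.rpow_pos_of_pos hk0 α
    have hC := Real.rpow_pos_of_pos Real.pi_pos α
    rw [inv_mul_le_iff₀ hC, ← div_eq_mul_inv, le_div_iff₀ hB, mul_comm]
    exact hle
  rw [latticeSymbol_eq_neg_tsum, neg_neg, mul_assoc]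
  have h6 := mul_le_mul_of_nonneg_left h5
    (by positivity : 0 ≤ ((d * 2 : ℝ) ^ ((d : ℝ) + α))⁻¹ * (1 / 4))
  linarith

/-! ### The on-diagonal local limit theorem -/

/-- The Fourier integrand of the return probability, extended by zero. -/
noncomputable def returnIntegrand (d : ℕ) (α r : ℝ) : (Fin d → ℝ) → ℝ :=
  (Set.univ.pi fun _ : Fin d => Set.Icc (-Real.pi) Real.pi).indicator
    fun θ => Real.exp (r * latticeSymbol d α θ)

lemma measurableSet_cube {d : ℕ} :
    MeasurableSet (Set.univ.pi fun _ : Fin d => Set.Icc (-Real.pi) Real.pi) :=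
  MeasurableSet.univ_pi fun _ => measurableSet_Icc

lemma mem_cube_iff {d : ℕ} (θ : Fin d → ℝ) :
    θ ∈ (Set.univ.pi fun _ : Fin d => Set.Icc (-Real.pi) Real.pi) ↔ ‖θ‖ ≤ Real.pi := by
  simp [pi_norm_le_iff_of_nonneg Real.pi_pos.le, abs_le, Pi.le_def, forall_and]

lemma pTrans_zero_eq {d : ℕ} (α r : ℝ) :
    pTrans d α r 0 = ((2 * Real.pi) ^ d)⁻¹ * ∫ θ, returnIntegrand d α r θ := by
  unfold returnIntegrand
  rw [integral_indicator measurableSet_cube]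
  simp [pTrans]

lemma returnIntegrand_nonneg {d : ℕ} (α r : ℝ) (θ : Fin d → ℝ) : 0 ≤ returnIntegrand d α r θ :=
  Set.indicator_nonneg (fun _ _ => (Real.exp_pos _).le) _

lemma measurable_uncurry_returnIntegrand {d : ℕ} (hd : 1 ≤ d) {α : ℝ} (hα : 0 < α) (hα2 : α < 2) :
    Measurable (fun z : ℝ × (Fin d → ℝ) => returnIntegrand d α z.1 z.2) := by
  have h := measurable_latticeSymbol hd hα hα2
  have h2 : Measurable fun z : ℝ × (Fin d → ℝ) => Real.exp (z.1 * latticeSymbol d α z.2) := by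
    fun_prop
  exact h2.indicator (measurable_snd (measurableSet_cube (d := d)))

lemma measurable_pTrans_zero {d : ℕ} (hd : 1 ≤ d) {α : ℝ} (hα : 0 < α) (hα2 : α < 2) :
    Measurable (fun r => pTrans d α r 0) := by
  simp only [pTrans_zero_eq]
  exact (StronglyMeasurable.integral_prod_right
    (measurable_uncurry_returnIntegrand hd hα hα2).stronglyMeasurable).measurable.const_mul _

lemma pTrans_zero_nonneg {d : ℕ} (α r : ℝ) : 0 ≤ pTrans d α r 0 := by
  rw [pTrans_zero_eq]
  exact mul_nonneg (by positivity) (integral_nonneg (returnIntegrand_nonneg α r))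

lemma pTrans_zero_le_one {d : ℕ} (α : ℝ) {r : ℝ} (hr : 0 ≤ r) : pTrans d α r 0 ≤ 1 := by
  have hvol : volume (Set.univ.pi fun _ : Fin d => Set.Icc (-Real.pi) Real.pi) =
      ENNReal.ofReal ((2 * Real.pi) ^ d) := by
    rw [volume_pi_pi]
    simp only [Real.volume_Icc, Finset.prod_const, Finset.card_univ, Fintype.card_fin]
    rw [ENNReal.ofReal_pow (by positivity)]
    ring_nf
  have h : ∫ θ, returnIntegrand d α r θ ≤ (2 * Real.pi) ^ d := by
    unfold returnIntegrand
    rw [integral_indicator measurableSet_cube]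
    have h1 := norm_setIntegral_le_of_norm_le_const (μ := volume)
      (s := Set.univ.pi fun _ : Fin d => Set.Icc (-Real.pi) Real.pi)
      (f := fun θ => Real.exp (r * latticeSymbol d α θ)) (C := 1)
      (by rw [hvol]; exact ENNReal.ofReal_lt_top) (fun θ _ => by
        rw [Real.norm_of_nonneg (Real.exp_pos _).le, Real.exp_le_one_iff]
        exact mul_nonpos_of_nonneg_of_nonpos hr (latticeSymbol_nonpos α θ))
    rw [Measure.real, hvol, ENNReal.toReal_ofReal (by positivity), one_mul] at h1
    exact (le_abs_self _).trans h1
  rw [pTrans_zero_eq, inv_mul_le_iff₀ (by positivity), mul_one]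
  exact h

lemma rpow_mul_pTrans_zero {d : ℕ} {α : ℝ} {r : ℝ} (hr : 0 < r) :
    r ^ ((d : ℝ) / α) * pTrans d α r 0 =
      ((2 * Real.pi) ^ d)⁻¹ * ∫ η, returnIntegrand d α r (r ^ (-α⁻¹) • η) := by
  have hp := Real.rpow_pos_of_pos hr (-α⁻¹)
  rw [pTrans_zero_eq, Measure.integral_comp_smul volume, Module.finrank_fin_fun,
    abs_of_pos (by positivity), smul_eq_mul, ← Real.rpow_natCast (r ^ (-α⁻¹)) d,
    ← Real.rpow_mul hr.le, ← Real.rpow_neg hr.le]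
  have : -(-α⁻¹ * (d : ℝ)) = d / α := by
    ring
  rw [this]
  ring

lemma returnIntegrand_smul_le {d : ℕ} {α c : ℝ} (hα : 0 < α)
    (hc : ∀ θ : Fin d → ℝ, ‖θ‖ ≤ Real.pi → c * ‖θ‖ ^ α ≤ -latticeSymbol d α θ)
    {r : ℝ} (hr : 0 < r) (η : Fin d → ℝ) :
    ‖returnIntegrand d α r (r ^ (-α⁻¹) • η)‖ ≤ Real.exp (-c * ‖η‖ ^ α) := by
  rw [Real.norm_of_nonneg (returnIntegrand_nonneg α r _)]
  refine Set.indicator_apply_le' (fun h => ?_) fun _ => (Real.exp_pos _).le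
  have h1 := hc _ ((mem_cube_iff _).1 h)
  have hp := Real.rpow_pos_of_pos hr (-α⁻¹)
  rw [norm_smul, Real.norm_of_nonneg hp.le, Real.mul_rpow hp.le (norm_nonneg _),
    ← Real.rpow_mul hr.le, neg_mul, inv_mul_cancel₀ hα.ne', Real.rpow_neg_one] at h1
  have h2 := mul_le_mul_of_nonneg_left h1 hr.le
  have h3 : r * (c * (r⁻¹ * ‖η‖ ^ α)) = c * ‖η‖ ^ α := by
    field_simp
  rw [h3] at h2
  exact Real.exp_le_exp.2 (by linarith)

lemma exists_rpow_mul_pTrans_zero_le {d : ℕ} (hd : 1 ≤ d) {α : ℝ} (hα : 0 < α) (hα2 : α < 2) :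
    ∃ C : ℝ, ∀ r : ℝ, 0 < r → r ^ ((d : ℝ) / α) * pTrans d α r 0 ≤ C := by
  have : Nonempty (Fin d) := ⟨⟨0, hd⟩⟩
  obtain ⟨c, hc0, hc⟩ := exists_mul_rpow_le_neg_latticeSymbol hd hα hα2
  refine ⟨((2 * Real.pi) ^ d)⁻¹ * ∫ η : Fin d → ℝ, Real.exp (-c * ‖η‖ ^ α), fun r hr => ?_⟩
  rw [rpow_mul_pTrans_zero hr]
  refine mul_le_mul_of_nonneg_left ?_ (by positivity)
  refine integral_mono_of_nonneg (Eventually.of_forall fun η => returnIntegrand_nonneg α r _)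
    (integrable_exp_neg_mul_norm_rpow volume hc0 hα) (Eventually.of_forall fun η => ?_)
  exact (le_abs_self _).trans (returnIntegrand_smul_le hα hc hr η)

lemma tendsto_returnIntegrand_smul {d : ℕ} (hd : 1 ≤ d) {α : ℝ} (hα : 0 < α) (hα2 : α < 2)
    (η : Fin d → ℝ) :
    Tendsto (fun r : ℝ => returnIntegrand d α r (r ^ (-α⁻¹) • η)) atTop
      (𝓝 (Real.exp (-(l2norm η ^ α * Gtilde d α)))) := by
  have h0 : Tendsto (fun r : ℝ => r ^ (-α⁻¹)) atTop (𝓝 0) :=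
    tendsto_rpow_neg_atTop (inv_pos.2 hα)
  have hε : Tendsto (fun r : ℝ => r ^ (-α⁻¹)) atTop (𝓝[>] 0) :=
    tendsto_nhdsWithin_iff.2 ⟨h0, by
      filter_upwards [eventually_gt_atTop 0] with r hr
      exact Real.rpow_pos_of_pos hr _⟩
  refine ((Real.continuous_exp.tendsto _).comp
    ((tendsto_rpow_neg_mul_latticeSymbol hd hα hα2 η).comp hε)).congr' ?_
  have hsmall : ∀ᶠ r : ℝ in atTop, ‖r ^ (-α⁻¹) • η‖ < Real.pi := by
    have h1 : Tendsto (fun r : ℝ => ‖r ^ (-α⁻¹) • η‖) atTop (𝓝 0) := by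
      simpa using (h0.smul_const η).norm
    exact h1.eventually_lt_const Real.pi_pos
  filter_upwards [hsmall, eventually_gt_atTop 0] with r hr hr0
  rw [returnIntegrand, Set.indicator_of_mem ((mem_cube_iff _).2 hr.le)]
  simp only [Function.comp_apply]
  rw [← Real.rpow_mul hr0.le, neg_mul_neg, inv_mul_cancel₀ hα.ne', Real.rpow_one]

/-- On-diagonal local limit theorem: `r ^ (d / α) * p_r(0, 0) → f_1(0)`. -/
theorem tendsto_rpow_mul_pTrans_zero {d : ℕ} (hd : 1 ≤ d) {α : ℝ} (hα : 0 < α) (hα2 : α < 2) :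
    Tendsto (fun r : ℝ => r ^ ((d : ℝ) / α) * pTrans d α r 0) atTop (𝓝 (fDensity d α 1 0)) := by
  have : Nonempty (Fin d) := ⟨⟨0, hd⟩⟩
  obtain ⟨c, hc0, hc⟩ := exists_mul_rpow_le_neg_latticeSymbol hd hα hα2
  have hf : fDensity d α 1 0 =
      ((2 * Real.pi) ^ d)⁻¹ * ∫ η : Fin d → ℝ, Real.exp (-(l2norm η ^ α * Gtilde d α)) := by
    simp [fDensity]
  rw [hf]
  have hlim : Tendsto (fun r : ℝ => ∫ η, returnIntegrand d α r (r ^ (-α⁻¹) • η)) atTop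
      (𝓝 (∫ η : Fin d → ℝ, Real.exp (-(l2norm η ^ α * Gtilde d α)))) := by
    refine tendsto_integral_filter_of_dominated_convergence _ ?_ ?_
      (integrable_exp_neg_mul_norm_rpow volume hc0 hα)
      (Eventually.of_forall fun η => tendsto_returnIntegrand_smul hd hα hα2 η)
    · refine Eventually.of_forall fun r => ?_
      exact ((measurable_uncurry_returnIntegrand hd hα hα2).comp
        (measurable_const.prodMk (measurable_const_smul _))).aestronglyMeasurable
    · filter_upwards [eventually_gt_atTop 0] with r hr
      exact Eventually.of_forall fun η => returnIntegrand_smul_le hα hc hr η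
  refine (hlim.const_mul _).congr' ?_
  filter_upwards [eventually_gt_atTop 0] with r hr
  rw [rpow_mul_pTrans_zero hr]

/-! ### A logarithmic Abelian lemma -/

lemma inv_log_mul_integral_Ioi_eq {p : ℝ → ℝ} {N : ℝ} (hN : 1 < N) :
    (Real.log N)⁻¹ * ∫ r in Set.Ioi (0 : ℝ), r * Real.exp (-r / N) * p r =
      ∫ s : ℝ, (N ^ s) ^ 2 * p (N ^ s) * Real.exp (-N ^ (s - 1)) := by
  have hN0 : 0 < N := by linarith
  have hlog : 0 < Real.log N := Real.log_pos hN
  have himg : (fun s : ℝ => N ^ s) '' Set.univ = Set.Ioi 0 := by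
    ext x
    simp only [Set.image_univ, Set.mem_range, Set.mem_Ioi]
    constructor
    · rintro ⟨s, rfl⟩
      exact Real.rpow_pos_of_pos hN0 s
    · intro hx
      exact ⟨Real.logb N x, Real.rpow_logb hN0 hN.ne' hx⟩
  have hderiv : ∀ s ∈ (Set.univ : Set ℝ),
      HasDerivWithinAt (fun s : ℝ => N ^ s) (N ^ s * Real.log N) Set.univ s := fun s _ =>
    (Real.hasStrictDerivAt_const_rpow hN0 s).hasDerivAt.hasDerivWithinAt
  rw [← himg, integral_image_eq_integral_abs_deriv_smul MeasurableSet.univ hderiv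
    (Real.strictMono_rpow_of_base_gt_one hN).injective.injOn, Measure.restrict_univ,
    ← integral_const_mul]
  refine integral_congr_ae (Eventually.of_forall fun s => ?_)
  have hs := Real.rpow_pos_of_pos hN0 s
  simp only [smul_eq_mul]
  rw [abs_of_pos (by positivity), Real.rpow_sub_one hN0.ne', neg_div]
  field_simp

/-- If `0 ≤ p ≤ 1`, `r² p(r)` is bounded and tends to `L`, then
`(log N)⁻¹ ∫₀^∞ r e^{-r/N} p(r) dr` tends to `L`. -/
theorem tendsto_inv_log_mul_integral {p : ℝ → ℝ} {C L : ℝ} (hmeas : Measurable p)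
    (hp0 : ∀ r, 0 < r → 0 ≤ p r) (hp1 : ∀ r, 0 < r → p r ≤ 1)
    (hC : ∀ r, 0 < r → r ^ 2 * p r ≤ C)
    (hL : Tendsto (fun r => r ^ 2 * p r) atTop (𝓝 L)) :
    Tendsto (fun N : ℝ => (Real.log N)⁻¹ *
      ∫ r in Set.Ioi (0 : ℝ), r * Real.exp (-r / N) * p r) atTop (𝓝 L) := by
  have hC0 : 0 ≤ C := le_trans (by have := hp0 1 one_pos; positivity) (hC 1 one_pos)
  have hlim : Tendsto (fun N : ℝ => ∫ s : ℝ, (N ^ s) ^ 2 * p (N ^ s) * Real.exp (-N ^ (s - 1)))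
      atTop (𝓝 (∫ s : ℝ, (Set.Ioo (0 : ℝ) 1).indicator (fun _ => L) s)) := by
    refine tendsto_integral_filter_of_dominated_convergence
      (fun s => (1 + C * Real.exp 1) * Real.exp (-1 * ‖s‖ ^ (1 : ℝ))) ?_ ?_
      ((integrable_exp_neg_mul_norm_rpow volume one_pos one_pos).const_mul _) ?_
    · refine Eventually.of_forall fun N => Measurable.aestronglyMeasurable ?_
      have h : Measurable fun s : ℝ => N ^ s := measurable_const.pow measurable_id
      have h' : Measurable fun s : ℝ => N ^ (s - 1) := h.comp (measurable_id.sub_const 1)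
      exact ((h.pow_const 2).mul (hmeas.comp h)).mul (Real.measurable_exp.comp h'.neg)
    · filter_upwards [eventually_ge_atTop (Real.exp 1)] with N hN
      refine Eventually.of_forall fun s => ?_
      have hN0 : 0 < N := (Real.exp_pos 1).trans_le hN
      have hs := Real.rpow_pos_of_pos hN0 s
      have hs1 := Real.rpow_pos_of_pos hN0 (s - 1)
      have hnn : 0 ≤ (N ^ s) ^ 2 * p (N ^ s) := mul_nonneg (by positivity) (hp0 _ hs)
      have hexp1 : Real.exp (-N ^ (s - 1)) ≤ 1 := Real.exp_le_one_iff.2 (by linarith)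
      have hneg : ∀ x : ℝ, x ≤ 0 → N ^ x ≤ Real.exp x := fun x hx =>
        (Real.rpow_le_rpow_of_nonpos (Real.exp_pos 1) hN hx).trans_eq (Real.exp_one_rpow x)
      rw [Real.norm_of_nonneg (mul_nonneg hnn (Real.exp_pos _).le), Real.rpow_one,
        Real.norm_eq_abs]
      rcases lt_or_ge s 0 with h | h
      · have h1 : N ^ s ≤ Real.exp s := hneg s h.le
        have h2 : Real.exp s ≤ 1 := Real.exp_le_one_iff.2 h.le
        rw [abs_of_neg h]
        calc (N ^ s) ^ 2 * p (N ^ s) * Real.exp (-N ^ (s - 1))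
            ≤ (N ^ s) ^ 2 * p (N ^ s) * 1 := by gcongr
          _ ≤ (N ^ s) ^ 2 := by
              rw [mul_one]
              exact mul_le_of_le_one_right (by positivity) (hp1 _ hs)
          _ ≤ 1 * Real.exp s := by nlinarith
          _ ≤ (1 + C * Real.exp 1) * Real.exp (-1 * -s) := by
              rw [neg_mul_neg, one_mul s]
              gcongr
              exact le_add_of_nonneg_right (by positivity)
      · have h1 : Real.exp (-N ^ (s - 1)) ≤ Real.exp (1 - s) := by
          rcases le_total s 1 with h' | h'
          · exact hexp1.trans (Real.one_le_exp (by linarith))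
          · refine Real.exp_le_exp.2 ?_
            have h2 : Real.exp (s - 1) ≤ N ^ (s - 1) := by
              rw [← Real.exp_one_rpow]
              exact Real.rpow_le_rpow (Real.exp_pos 1).le hN (by linarith)
            linarith [Real.add_one_le_exp (s - 1)]
        rw [abs_of_nonneg h]
        calc (N ^ s) ^ 2 * p (N ^ s) * Real.exp (-N ^ (s - 1))
            ≤ C * Real.exp (1 - s) := mul_le_mul (hC _ hs) h1 (Real.exp_pos _).le hC0
          _ = C * Real.exp 1 * Real.exp (-1 * s) := by
              rw [mul_assoc, ← Real.exp_add]
              ring_nf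
          _ ≤ _ := by
              gcongr
              linarith
    · have hne : ∀ x : ℝ, ∀ᵐ s : ℝ, s ≠ x := fun x => by
        simp [ae_iff, measure_singleton]
      filter_upwards [hne 0, hne 1] with s hs0 hs1
      have hpow : ∀ x : ℝ, x < 0 → Tendsto (fun N : ℝ => N ^ x) atTop (𝓝 0) := fun x hx => by
        simpa using tendsto_rpow_neg_atTop (neg_pos.2 hx)
      by_cases hmem : s ∈ Set.Ioo (0 : ℝ) 1
      · rw [Set.indicator_of_mem hmem]
        have h1 := hL.comp (tendsto_rpow_atTop hmem.1)
        have h2 : Tendsto (fun N : ℝ => Real.exp (-N ^ (s - 1))) atTop (𝓝 1) := by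
          have h3 := (hpow (s - 1) (by linarith [hmem.2])).neg
          rw [neg_zero] at h3
          have h4 := (Real.continuous_exp.tendsto 0).comp h3
          rwa [Real.exp_zero] at h4
        simpa using h1.mul h2
      · rw [Set.indicator_of_notMem hmem]
        rcases lt_or_gt_of_ne hs0 with h | h
        · have h1 : Tendsto (fun N : ℝ => (N ^ s) ^ 2) atTop (𝓝 0) := by
            simpa using (hpow s h).pow 2
          refine squeeze_zero' ?_ ?_ h1 <;>
          filter_upwards [eventually_gt_atTop 0] with N hN
          · have hs := Real.rpow_pos_of_pos hN s
            have := hp0 _ hs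
            positivity
          · have hs := Real.rpow_pos_of_pos hN s
            rw [mul_assoc]
            refine mul_le_of_le_one_right (by positivity)
              (mul_le_one₀ (hp1 _ hs) (Real.exp_pos _).le (Real.exp_le_one_iff.2 ?_))
            linarith [Real.rpow_pos_of_pos hN (s - 1)]
        · have hs : 1 < s := lt_of_le_of_ne (not_lt.1 fun h' => hmem ⟨h, h'⟩) hs1.symm
          have h1 := hL.comp (tendsto_rpow_atTop h)
          have h2 : Tendsto (fun N : ℝ => Real.exp (-N ^ (s - 1))) atTop (𝓝 0) :=
            Real.tendsto_exp_neg_atTop_nhds_zero.comp (tendsto_rpow_atTop (by linarith))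
          simpa using h1.mul h2
  have hint : ∫ s : ℝ, (Set.Ioo (0 : ℝ) 1).indicator (fun _ => L) s = L := by
    rw [integral_indicator measurableSet_Ioo]
    simp
  rw [hint] at hlim
  refine hlim.congr' ?_
  filter_upwards [eventually_gt_atTop 1] with N hN
  exact (inv_log_mul_integral_Ioi_eq hN).symm

/-- **Logarithmic Tauberian limit in the critical case `α = d/2`** (from the proof of
Lemma 4.8): for `d ∈ {1,2,3}`,
`lim_{N→∞} (log N)⁻¹ ∫_0^∞ r e^{−r/N} p_r^{d,d/2}(0,0) dr = f_1^{d,d/2}(0)`,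
the limit being over real `N > 1`. -/
theorem log_tauberian_limit (d : ℕ) (hd1 : 1 ≤ d) (hd3 : d ≤ 3) :
    Tendsto
      (fun N : ℝ => (Real.log N)⁻¹ *
        ∫ r in Set.Ioi (0 : ℝ), r * Real.exp (-r / N) * pTrans d ((d : ℝ) / 2) r (0 : Fin d → ℤ))
      atTop (𝓝 (fDensity d ((d : ℝ) / 2) 1 (0 : Fin d → ℝ))) := by
  have hd0 : (0 : ℝ) < d := by exact_mod_cast hd1
  have hd3' : (d : ℝ) ≤ 3 := by exact_mod_cast hd3
  have hα : (0 : ℝ) < d / 2 := by linarith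
  have hα2 : (d : ℝ) / 2 < 2 := by linarith
  have hexp : (d : ℝ) / (d / 2) = (2 : ℕ) := by
    push_cast
    field_simp
  obtain ⟨C, hC⟩ := exists_rpow_mul_pTrans_zero_le hd1 hα hα2
  have hL := tendsto_rpow_mul_pTrans_zero hd1 hα hα2
  simp only [hexp, Real.rpow_natCast] at hC hL
  exact tendsto_inv_log_mul_integral (measurable_pTrans_zero hd1 hα hα2)
    (fun r _ => pTrans_zero_nonneg _ r) (fun r hr => pTrans_zero_le_one _ hr.le) hC hL
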